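/- arXiv:math/0502031 — 2 statements merged into one kernel-verified Lean document; each statement's English description precedes it below -/
import Mathlib

section
/- Let U ⊆ ℝⁿ be open, let f0, f1 be smooth vector fields on U, and let α, β : U → ℝ be smooth functions. Set f̃0 = f0 + α·f1 and f̃1 = β·f1. Then at every point q ∈ U, the vector [f̃0,[f̃0,f̃1]](q) − β(q)·[f0,[f0,f1]](q) + α(q)·β(q)·[f1,[f1,f0]](q) lies in the linear span of f1(q) and [f0,f1](q). -/
/-- A (globally defined) vector field on `ℝⁿ`. -/
abbrev VF (n : ℕ) := (Fin n → ℝ) → (Fin n → ℝ)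

/-- The Lie bracket of vector fields: `[X,Y](x) = DY(x)(X(x)) − DX(x)(Y(x))`. -/
noncomputable def vbracket {n : ℕ} (X Y : VF n) : VF n := fun x =>
  fderiv ℝ Y x (X x) - fderiv ℝ X x (Y x)

/-- Iterated adjoint: `(ad X)^k Y`, with `(ad X)^0 Y = Y` and
`(ad X)^k Y = [X, (ad X)^{k-1} Y]`. -/
noncomputable def adPow {n : ℕ} (k : ℕ) (X Y : VF n) : VF n :=
  (fun Z => vbracket X Z)^[k] Y

/-- Pointwise scalar multiple `α·X` of a vector field. -/
def smulVF {n : ℕ} (α : (Fin n → ℝ) → ℝ) (X : VF n) : VF n := fun x => α x • X x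

/-- Pointwise sum of vector fields. -/
def addVF {n : ℕ} (X Y : VF n) : VF n := fun x => X x + Y x

/-- The bracket is a derivation in its second argument. -/
theorem vbracket_smulVF_right {n : ℕ} {X Y : VF n} {β : (Fin n → ℝ) → ℝ} {x : Fin n → ℝ}
    (hβ : DifferentiableAt ℝ β x) (hY : DifferentiableAt ℝ Y x) :
    vbracket X (smulVF β Y) x = fderiv ℝ β x (X x) • Y x + β x • vbracket X Y x :=
  VectorField.lieBracket_smul_right hβ hY

theorem vbracket_addVF_right {n : ℕ} {X Y Z : VF n} {x : Fin n → ℝ}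
    (hY : DifferentiableAt ℝ Y x) (hZ : DifferentiableAt ℝ Z x) :
    vbracket X (addVF Y Z) x = vbracket X Y x + vbracket X Z x :=
  VectorField.lieBracket_add_right hY hZ

/-- The bracket with `X + α·Y` in its first argument. -/
theorem vbracket_addVF_smulVF_left {n : ℕ} {X Y Z : VF n} {α : (Fin n → ℝ) → ℝ}
    {x : Fin n → ℝ} (hα : DifferentiableAt ℝ α x) (hX : DifferentiableAt ℝ X x)
    (hY : DifferentiableAt ℝ Y x) :
    vbracket (addVF X (smulVF α Y)) Z x =
      vbracket X Z x + (-(fderiv ℝ α x (Z x)) • Y x + α x • vbracket Y Z x) :=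
  (VectorField.lieBracket_add_left hX (hα.smul hY)).trans
    (congrArg (vbracket X Z x + ·) (VectorField.lieBracket_smul_left hα hY))

theorem vbracket_swap {n : ℕ} (X Y : VF n) (x : Fin n → ℝ) :
    vbracket X Y x = -vbracket Y X x :=
  VectorField.lieBracket_swap

theorem vbracket_self {n : ℕ} (X : VF n) (x : Fin n → ℝ) : vbracket X X x = 0 :=
  sub_self _

theorem vbracket_congr_right {n : ℕ} {X Y Z : VF n} {x : Fin n → ℝ}
    (h : Y =ᶠ[nhds x] Z) : vbracket X Y x = vbracket X Z x :=
  Filter.EventuallyEq.lieBracket_vectorField_eq (Filter.EventuallyEq.refl _ X) h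

/-- with `f̃0 = f0 + α·f1` and `f̃1 = β·f1`, at every `q ∈ U` the vector
`[f̃0,[f̃0,f̃1]](q) − β(q)·[f0,[f0,f1]](q) + α(q)·β(q)·[f1,[f1,f0]](q)` lies in the
span of `f1(q)` and `[f0,f1](q)`. -/
theorem stmt_16 (n : ℕ) (U : Set (Fin n → ℝ)) (hU : IsOpen U) (f0 f1 : VF n)
    (hf0 : ContDiffOn ℝ (⊤ : ℕ∞) f0 U) (hf1 : ContDiffOn ℝ (⊤ : ℕ∞) f1 U)
    (α β : (Fin n → ℝ) → ℝ)
    (hα : ContDiffOn ℝ (⊤ : ℕ∞) α U) (hβ : ContDiffOn ℝ (⊤ : ℕ∞) β U) :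
    ∀ q ∈ U,
      vbracket (addVF f0 (smulVF α f1)) (vbracket (addVF f0 (smulVF α f1))
          (smulVF β f1)) q -
        β q • vbracket f0 (vbracket f0 f1) q +
        (α q * β q) • vbracket f1 (vbracket f1 f0) q ∈
      Submodule.span ℝ {f1 q, vbracket f0 f1 q} := by
  intro q hq
  have diff {F : Type} [NormedAddCommGroup F] [NormedSpace ℝ F] {f : (Fin n → ℝ) → F}
      (hf : ContDiffOn ℝ (⊤ : ℕ∞) f U) {x} (hx : x ∈ U) : DifferentiableAt ℝ f x :=
    (hf.contDiffAt (hU.mem_nhds hx)).differentiableAt (by simp)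
  have smooth_deriv {F : Type} [NormedAddCommGroup F] [NormedSpace ℝ F]
      {f : (Fin n → ℝ) → F} {X : VF n} (hf : ContDiffOn ℝ (⊤ : ℕ∞) f U)
      (hX : ContDiffOn ℝ (⊤ : ℕ∞) X U) :
      ContDiffOn ℝ (⊤ : ℕ∞) (fun x => fderiv ℝ f x (X x)) U :=
    (hf.fderiv_of_isOpen hU (by simp)).clm_apply hX
  set g : VF n := vbracket f0 f1
  set h0 : VF n := addVF f0 (smulVF α f1)
  have hg : ContDiffOn ℝ (⊤ : ℕ∞) g U := (smooth_deriv hf1 hf0).sub (smooth_deriv hf0 hf1)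
  have hh0 : ContDiffOn ℝ (⊤ : ℕ∞) h0 U := hf0.add (hα.smul hf1)
  let γ : (Fin n → ℝ) → ℝ := fun x => fderiv ℝ β x (h0 x) - β x * fderiv ℝ α x (f1 x)
  have hγ : ContDiffOn ℝ (⊤ : ℕ∞) γ U := (smooth_deriv hβ hh0).sub (hβ.mul (smooth_deriv hα hf1))
  have h0_f1 : ∀ x ∈ U, vbracket h0 f1 x = g x - fderiv ℝ α x (f1 x) • f1 x := by
    intro x hx
    rw [vbracket_addVF_smulVF_left (diff hα hx) (diff hf0 hx) (diff hf1 hx), vbracket_self,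
      smul_zero, add_zero, neg_smul, sub_eq_add_neg]
  have inner_eq : vbracket h0 (smulVF β f1) =ᶠ[nhds q] addVF (smulVF β g) (smulVF γ f1) := by
    filter_upwards [hU.mem_nhds hq] with x hx
    rw [vbracket_smulVF_right (diff hβ hx) (diff hf1 hx), h0_f1 x hx]
    simp only [addVF, smulVF, γ]
    module
  have f1_g : vbracket f1 g q = -vbracket f1 (vbracket f1 f0) q := by
    have hswap : g = -vbracket f1 f0 := funext fun x => vbracket_swap f0 f1 x
    rw [hswap]
    simp [vbracket, fderiv_neg]
    abel
  rw [vbracket_congr_right inner_eq,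
    vbracket_addVF_right (Y := smulVF β g) (Z := smulVF γ f1)
      ((diff hβ hq).smul (diff hg hq)) ((diff hγ hq).smul (diff hf1 hq)),
    vbracket_smulVF_right (diff hβ hq) (diff hg hq),
    vbracket_smulVF_right (diff hγ hq) (diff hf1 hq), h0_f1 q hq,
    vbracket_addVF_smulVF_left (diff hα hq) (diff hf0 hq) (diff hf1 hq), f1_g,
    Submodule.mem_span_pair]
  refine ⟨fderiv ℝ γ q (h0 q) - β q * fderiv ℝ α q (g q) - γ q * fderiv ℝ α q (f1 q),
    fderiv ℝ β q (h0 q) + γ q, ?_⟩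
  module
end

section
/- Let U ⊆ ℝⁿ be open, let f0, f1 be smooth vector fields on U, let α, β : U → ℝ be smooth with β nowhere zero, and set f̃0 = f0 + α·f1, f̃1 = β·f1. Then for every positive integer k and every point q ∈ U, the vector ((ad f1)^k f0)(q) lies in the linear span of the vectors f̃1(q), ((ad f̃1)f̃0)(q), ((ad f̃1)²f̃0)(q), …, ((ad f̃1)^k f̃0)(q). -/
open VectorField Set Filter Topology

theorem ContDiffOn.differentiableAt_of_isOpen {E F : Type*} [NormedAddCommGroup E]
    [NormedSpace ℝ E] [NormedAddCommGroup F] [NormedSpace ℝ F] {U : Set E} (hU : IsOpen U)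
    {f : E → F} (hf : ContDiffOn ℝ (⊤ : ℕ∞) f U) {q : E} (hq : q ∈ U) : DifferentiableAt ℝ f q :=
  (hf.contDiffAt (hU.mem_nhds hq)).differentiableAt (by simp)

/-- The vector fields that on `U` are finite combinations of members of `S` with coefficients
smooth on `U`. -/
inductive SmoothSpan {E : Type*} [NormedAddCommGroup E] [NormedSpace ℝ E]
    (U : Set E) (S : Set (E → E)) : (E → E) → Prop
  | smul {c : E → ℝ} {X : E → E} (hc : ContDiffOn ℝ (⊤ : ℕ∞) c U) (hX : X ∈ S) :
      SmoothSpan U S (c • X)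
  | add {V W : E → E} (hV : SmoothSpan U S V) (hW : SmoothSpan U S W) : SmoothSpan U S (V + W)
  | congr {V W : E → E} (hV : SmoothSpan U S V) (h : EqOn W V U) : SmoothSpan U S W

namespace SmoothSpan

variable {E : Type*} [NormedAddCommGroup E] [NormedSpace ℝ E] {U : Set E} {S T : Set (E → E)}

theorem of_mem {X : E → E} (hX : X ∈ S) : SmoothSpan U S X :=
  (smul (c := fun _ => 1) contDiffOn_const hX).congr fun q _ => by simp

theorem smooth_smul {c : E → ℝ} (hc : ContDiffOn ℝ (⊤ : ℕ∞) c U) {V : E → E}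
    (hV : SmoothSpan U S V) : SmoothSpan U S (c • V) := by
  induction hV with
  | smul hd hX => exact (smul (hc.mul hd) hX).congr fun q _ => by simp [mul_smul]
  | add _ _ ihV ihW => exact (ihV.add ihW).congr fun q _ => by simp
  | congr _ h ih => exact ih.congr fun q hq => by simp [h hq]

theorem contDiffOn (hS : ∀ X ∈ S, ContDiffOn ℝ (⊤ : ℕ∞) X U) {V : E → E}
    (hV : SmoothSpan U S V) : ContDiffOn ℝ (⊤ : ℕ∞) V U := by
  induction hV with
  | smul hc hX => exact hc.smul (hS _ hX)
  | add _ _ ihV ihW => exact ihV.add ihW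
  | congr _ h ih => exact ih.congr h

theorem mem_span {V : E → E} (hV : SmoothSpan U S V) {q : E} (hq : q ∈ U) :
    V q ∈ Submodule.span ℝ ((fun X : E → E => X q) '' S) := by
  induction hV with
  | smul _ hX => exact Submodule.smul_mem _ _ (Submodule.subset_span (mem_image_of_mem _ hX))
  | add _ _ ihV ihW => exact add_mem ihV ihW
  | congr _ h ih => rw [h hq]; exact ih

/-- Bracketing with a smooth field sends the smooth span of `S` to that of `T`, as soon as it does
so for the generators. -/
theorem lieBracket (hU : IsOpen U) (hST : S ⊆ T)
    (hS : ∀ X ∈ S, ContDiffOn ℝ (⊤ : ℕ∞) X U) {Y : E → E} (hY : ContDiffOn ℝ (⊤ : ℕ∞) Y U)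
    (hbr : ∀ X ∈ S, SmoothSpan U T (lieBracket ℝ Y X)) {V : E → E} (hV : SmoothSpan U S V) :
    SmoothSpan U T (lieBracket ℝ Y V) := by
  induction hV with
  | @smul c X hc hX =>
    have hYc : ContDiffOn ℝ (⊤ : ℕ∞) (fun x => fderiv ℝ c x (Y x)) U :=
      (hc.fderiv_of_isOpen hU (by simp)).clm_apply hY
    refine ((smul hYc (hST hX)).add ((hbr X hX).smooth_smul hc)).congr fun q hq => ?_
    exact lieBracket_smul_right (hc.differentiableAt_of_isOpen hU hq)
      ((hS X hX).differentiableAt_of_isOpen hU hq)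
  | add hV hW ihV ihW =>
    exact (ihV.add ihW).congr fun q hq =>
      lieBracket_add_right ((hV.contDiffOn hS).differentiableAt_of_isOpen hU hq)
        ((hW.contDiffOn hS).differentiableAt_of_isOpen hU hq)
  | congr _ h ih =>
    exact ih.congr fun q hq => EventuallyEq.lieBracket_vectorField_eq EventuallyEq.rfl
      (h.eventuallyEq_of_mem (hU.mem_nhds hq))

/-- If `Y = γ • X` on `U` with `X ∈ S`, then bracketing with `Y` lands in the smooth span of `S`
whenever bracketing with `X` does. -/
theorem lieBracket_of_eqOn_smul (hU : IsOpen U) {X Y Z : E → E} {γ : E → ℝ}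
    (hγ : ContDiffOn ℝ (⊤ : ℕ∞) γ U) (hX : ContDiffOn ℝ (⊤ : ℕ∞) X U)
    (hZ : ContDiffOn ℝ (⊤ : ℕ∞) Z U) (hY : EqOn Y (γ • X) U) (hXS : X ∈ S)
    (hXZ : SmoothSpan U S (VectorField.lieBracket ℝ X Z)) :
    SmoothSpan U S (VectorField.lieBracket ℝ Y Z) := by
  have hZγ : ContDiffOn ℝ (⊤ : ℕ∞) (fun x => -fderiv ℝ γ x (Z x)) U :=
    ((hγ.fderiv_of_isOpen hU (by simp)).clm_apply hZ).neg
  refine ((smul hZγ hXS).add (hXZ.smooth_smul hγ)).congr fun q hq => ?_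
  rw [EventuallyEq.lieBracket_vectorField_eq (hY.eventuallyEq_of_mem (hU.mem_nhds hq))
    EventuallyEq.rfl]
  exact lieBracket_smul_left (hγ.differentiableAt_of_isOpen hU hq)
    (hX.differentiableAt_of_isOpen hU hq)

end SmoothSpan

theorem ContDiffOn.lieBracket_of_isOpen {E : Type*} [NormedAddCommGroup E] [NormedSpace ℝ E]
    {U : Set E} (hU : IsOpen U) {X Y : E → E} (hX : ContDiffOn ℝ (⊤ : ℕ∞) X U)
    (hY : ContDiffOn ℝ (⊤ : ℕ∞) Y U) : ContDiffOn ℝ (⊤ : ℕ∞) (lieBracket ℝ X Y) U :=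
  (hX.lieBracketWithin_vectorField hY hU.uniqueDiffOn (by simp)).congr fun _ hq =>
    (lieBracketWithin_of_isOpen hU hq).symm

theorem adPow_succ {n : ℕ} (k : ℕ) (X Y : VF n) :
    adPow (k + 1) X Y = lieBracket ℝ X (adPow k X Y) :=
  Function.iterate_succ_apply' _ _ _

theorem contDiffOn_adPow {n : ℕ} {U : Set (Fin n → ℝ)} (hU : IsOpen U) {X Y : VF n}
    (hX : ContDiffOn ℝ (⊤ : ℕ∞) X U) (hY : ContDiffOn ℝ (⊤ : ℕ∞) Y U) (k : ℕ) :
    ContDiffOn ℝ (⊤ : ℕ∞) (adPow k X Y) U := by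
  induction k with
  | zero => exact hY
  | succ k ih => rw [adPow_succ]; exact hX.lieBracket_of_isOpen hU ih

/-- If `Y = γ • X` and `Z = W + δ • X` on `U`, then `(ad Y)^k Z` is for `k ≥ 1` a smooth combination
of `X` and `(ad X)^m W` with `1 ≤ m ≤ k`. -/
theorem smoothSpan_adPow {n : ℕ} {U : Set (Fin n → ℝ)} (hU : IsOpen U) {X Y Z W : VF n}
    {γ δ : (Fin n → ℝ) → ℝ} (hX : ContDiffOn ℝ (⊤ : ℕ∞) X U) (hW : ContDiffOn ℝ (⊤ : ℕ∞) W U)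
    (hγ : ContDiffOn ℝ (⊤ : ℕ∞) γ U) (hδ : ContDiffOn ℝ (⊤ : ℕ∞) δ U)
    (hY : EqOn Y (γ • X) U) (hZ : EqOn Z (W + δ • X) U) (k : ℕ) :
    SmoothSpan U ({X} ∪ {V | ∃ m, 1 ≤ m ∧ m ≤ k + 1 ∧ V = adPow m X W})
      (adPow (k + 1) Y Z) := by
  have hYs : ContDiffOn ℝ (⊤ : ℕ∞) Y U := (hγ.smul hX).congr hY
  have hself (S : Set (VF n)) (hXS : X ∈ S) : SmoothSpan U S (lieBracket ℝ Y X) := by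
    refine SmoothSpan.lieBracket_of_eqOn_smul hU hγ hX hX hY hXS ?_
    exact (SmoothSpan.smul (c := fun _ => 0) contDiffOn_const hXS).congr fun q _ => by simp
  induction k with
  | zero =>
    rw [adPow_succ]
    have hW1 : SmoothSpan U ({X} ∪ {V | ∃ m, 1 ≤ m ∧ m ≤ 0 + 1 ∧ V = adPow m X W})
        (lieBracket ℝ Y W) :=
      SmoothSpan.lieBracket_of_eqOn_smul hU hγ hX hW hY (by simp)
        (SmoothSpan.of_mem (Or.inr ⟨1, le_rfl, le_rfl, rfl⟩))
    have hX1 : SmoothSpan U ({X} ∪ {V | ∃ m, 1 ≤ m ∧ m ≤ 0 + 1 ∧ V = adPow m X W})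
        (lieBracket ℝ Y (δ • X)) :=
      SmoothSpan.lieBracket hU subset_union_left (by rintro V rfl; exact hX) hYs
        (by rintro V rfl; exact hself _ (by simp)) (SmoothSpan.smul hδ (mem_singleton X))
    refine (hW1.add hX1).congr fun q hq => ?_
    exact (EventuallyEq.lieBracket_vectorField_eq EventuallyEq.rfl
      (hZ.eventuallyEq_of_mem (hU.mem_nhds hq))).trans
      (lieBracket_add_right (hW.differentiableAt_of_isOpen hU hq)
        ((hδ.smul hX).differentiableAt_of_isOpen hU hq))
  | succ k ih =>
    rw [adPow_succ]
    refine SmoothSpan.lieBracket hU (union_subset_union_right _ ?_) ?_ hYs ?_ ih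
    · rintro V ⟨m, h1, h2, rfl⟩
      exact ⟨m, h1, by omega, rfl⟩
    · rintro V (rfl | ⟨m, h1, h2, rfl⟩)
      exacts [hX, contDiffOn_adPow hU hX hW m]
    · rintro V (rfl | ⟨m, h1, h2, rfl⟩)
      · exact hself _ (by simp)
      · refine SmoothSpan.lieBracket_of_eqOn_smul hU hγ hX (contDiffOn_adPow hU hX hW m) hY
          (by simp) (SmoothSpan.of_mem (Or.inr ⟨m + 1, by omega, by omega, ?_⟩))
        rw [adPow_succ]

/-- with `f̃0 = f0 + α·f1` and `f̃1 = β·f1` (`β` nowhere zero on `U`),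
for every `k ≥ 1` and every `q ∈ U` the vector `((ad f1)^k f0)(q)` lies in the span of
`f̃1(q), ((ad f̃1) f̃0)(q), …, ((ad f̃1)^k f̃0)(q)`. -/
theorem stmt_17 (n : ℕ) (U : Set (Fin n → ℝ)) (hU : IsOpen U) (f0 f1 : VF n)
    (hf0 : ContDiffOn ℝ (⊤ : ℕ∞) f0 U) (hf1 : ContDiffOn ℝ (⊤ : ℕ∞) f1 U)
    (α β : (Fin n → ℝ) → ℝ)
    (hα : ContDiffOn ℝ (⊤ : ℕ∞) α U) (hβ : ContDiffOn ℝ (⊤ : ℕ∞) β U)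
    (hβ0 : ∀ q ∈ U, β q ≠ 0) :
    ∀ k : ℕ, 0 < k → ∀ q ∈ U,
      adPow k f1 f0 q ∈ Submodule.span ℝ
        ({smulVF β f1 q} ∪
          {v | ∃ m, 1 ≤ m ∧ m ≤ k ∧
            v = adPow m (smulVF β f1) (addVF f0 (smulVF α f1)) q}) := by
  intro k hk q hq
  obtain ⟨k, rfl⟩ := Nat.exists_eq_add_of_lt hk
  rw [zero_add]
  have hβi : ContDiffOn ℝ (⊤ : ℕ∞) (fun x => (β x)⁻¹) U := hβ.inv hβ0
  have hδ : ContDiffOn ℝ (⊤ : ℕ∞) (fun x => -(α x * (β x)⁻¹)) U := (hα.mul hβi).neg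
  have h := (smoothSpan_adPow hU (hβ.smul hf1 : ContDiffOn ℝ (⊤ : ℕ∞) (smulVF β f1) U)
    (hf0.add (hα.smul hf1) : ContDiffOn ℝ (⊤ : ℕ∞) (addVF f0 (smulVF α f1)) U) hβi hδ
    (Y := f1) (Z := f0) (fun x hx => by simp [smul_smul, hβ0 x hx])
    (fun x hx => by simp [smulVF, smul_smul, hβ0 x hx]) k).mem_span hq
  refine Submodule.span_mono ?_ h
  rintro _ ⟨V, rfl | ⟨m, h1, h2, rfl⟩, rfl⟩
  · exact Or.inl rfl
  · exact Or.inr ⟨m, h1, h2, rfl⟩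
end
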